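/- Let k ≥ 1 and p₁ > k, p₂ ≥ k, let G = K_{p₁} ∘_k K_{p₂}, t = p₁ + p₂ − k, and let L be the Laplacian matrix of G. Then for every vertex i ∈ T, every vertex j ∈ A, and every matrix X with L·X·L = L, one has X_{ii} + X_{jj} − X_{ij} − X_{ji} = ((k+1)(p₂ − k) + 2p₁k)/(k·p₁·t); that is, the resistance distance between an identified vertex and a non-identified vertex of K_{p₁} equals ((k+1)(p₂−k) + 2p₁k)/(k p₁ t). -/

import Mathlib

open Matrix BigOperators

-- The Laplacian matrix `L = D − A` of a finite simple graph, over `ℝ`.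
open Classical in
noncomputable def lapMat {V : Type} [Fintype V] (G : SimpleGraph V) : Matrix V V ℝ :=
  Matrix.of fun i j =>
    if i = j then (Nat.card {v // G.Adj i v} : ℝ)
    else if G.Adj i j then -1 else 0

/-- Vertex set of the `k`-coalescence `K_{p₁} ∘ₖ K_{p₂}`: the identified clique `T`
(of size `k`), the remaining vertices `A` of `K_{p₁}` (size `a = p₁ − k`) and the
remaining vertices `B` of `K_{p₂}` (size `b = p₂ − k`). -/
abbrev CoalV (k a b : ℕ) := Fin k ⊕ (Fin a ⊕ Fin b)

/-- `u` lies in the part `A`. -/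
def memA {k a b : ℕ} : CoalV k a b → Prop
  | Sum.inr (Sum.inl _) => True
  | _ => False

/-- `u` lies in the part `B`. -/
def memB {k a b : ℕ} : CoalV k a b → Prop
  | Sum.inr (Sum.inr _) => True
  | _ => False

/-- The `k`-coalescence `K_{p₁} ∘ₖ K_{p₂}` (with `a = p₁ − k`, `b = p₂ − k`):
two distinct vertices are adjacent iff they do not lie one in `A` and one in `B`. -/
def KCoal (k a b : ℕ) : SimpleGraph (CoalV k a b) :=
  SimpleGraph.fromRel (fun u v => ¬((memA u ∧ memB v) ∨ (memB u ∧ memA v)))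

theorem lapMat_mulVec_apply {V : Type} [Fintype V] (G : SimpleGraph V) [DecidableRel G.Adj]
    (y : V → ℝ) (u : V) :
    (lapMat G *ᵥ y) u = ∑ v, if G.Adj u v then y u - y v else 0 := by
  classical
  have hdeg : (Nat.card {v // G.Adj u v} : ℝ) = ∑ v, if G.Adj u v then (1 : ℝ) else 0 := by
    rw [Nat.card_eq_fintype_card, Fintype.card_subtype]
    simp
  have hsplit : ∀ v, lapMat G u v * y v =
      (if u = v then (Nat.card {w // G.Adj u w} : ℝ) * y u else 0)
        - (if G.Adj u v then y v else 0) := by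
    intro v
    by_cases huv : u = v
    · subst huv
      simp [lapMat]
    · by_cases hadj : G.Adj u v <;> simp [lapMat, huv, hadj]
  simp only [Matrix.mulVec, dotProduct, hsplit, Finset.sum_sub_distrib, Finset.sum_ite_eq,
    Finset.mem_univ, if_true]
  rw [hdeg, Finset.sum_mul, ← Finset.sum_sub_distrib]
  refine Finset.sum_congr rfl fun v _ => ?_
  split_ifs <;> ring

theorem lapMat_transpose {V : Type} [Fintype V] (G : SimpleGraph V) :
    (lapMat G)ᵀ = lapMat G := by
  ext u v
  by_cases huv : u = v
  · subst huv
    rfl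
  · have hcomm := G.adj_comm u v
    by_cases hadj : G.Adj u v <;> simp_all [lapMat, Ne.symm huv]

/-- If `L y = e_u - e_v`, then every `{1}`-inverse of `L` computes the resistance distance
between `u` and `v` as the potential difference `y u - y v`. -/
theorem resistance_eq_potential_diff {V : Type} [Fintype V] [DecidableEq V] (G : SimpleGraph V)
    (X : Matrix V V ℝ) (hX : lapMat G * X * lapMat G = lapMat G) (y : V → ℝ) (u v : V)
    (hy : lapMat G *ᵥ y = Pi.single u 1 - Pi.single v 1) :
    X u u + X v v - X u v - X v u = y u - y v := by
  have hy' : y ᵥ* lapMat G = Pi.single u 1 - Pi.single v 1 := by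
    rw [← Matrix.mulVec_transpose, lapMat_transpose, hy]
  have key : y ⬝ᵥ ((lapMat G * X * lapMat G) *ᵥ y) = y ⬝ᵥ (lapMat G *ᵥ y) := by rw [hX]
  rw [← Matrix.mulVec_mulVec, ← Matrix.mulVec_mulVec, Matrix.dotProduct_mulVec, hy', hy] at key
  simp [Matrix.mulVec_sub, sub_dotProduct, dotProduct_sub] at key
  linarith

/-- The Laplacian of the `k`-coalescence in terms of the sum over each part. -/
theorem lapMat_KCoal_mulVec (k a b : ℕ) (x : Fin k → ℝ) (y : Fin a → ℝ) (z : Fin b → ℝ) :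
    lapMat (KCoal k a b) *ᵥ Sum.elim x (Sum.elim y z) =
      Sum.elim (fun i => (k + a + b) * x i - (∑ l, x l + ∑ l, y l + ∑ l, z l))
        (Sum.elim (fun j => (k + a) * y j - (∑ l, x l + ∑ l, y l))
          (fun m => (k + b) * z m - (∑ l, x l + ∑ l, z l))) := by
  classical
  have hadj : ∀ (w : CoalV k a b → ℝ) (u v : CoalV k a b),
      (if (KCoal k a b).Adj u v then w u - w v else 0) =
        if (memA u ∧ memB v) ∨ (memB u ∧ memA v) then 0 else w u - w v := by
    intro w u v
    by_cases huv : u = v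
    · subst huv
      simp
    · have hiff : (KCoal k a b).Adj u v ↔ ¬((memA u ∧ memB v) ∨ (memB u ∧ memA v)) := by
        simp only [KCoal, SimpleGraph.fromRel_adj]
        tauto
      simp only [hiff, ite_not]
  ext u
  rw [lapMat_mulVec_apply]
  simp only [hadj, Fintype.sum_sum_type]
  rcases u with i | j | m <;>
    simp [memA, memB, Finset.sum_sub_distrib] <;> ring

theorem exists_potential_KCoal (k a b : ℕ) (hk : 1 ≤ k) (i : Fin k) (j : Fin a) :
    ∃ y : CoalV k a b → ℝ,
      lapMat (KCoal k a b) *ᵥ y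
        = Pi.single (Sum.inl i) 1 - Pi.single (Sum.inr (Sum.inl j)) 1 ∧
      y (Sum.inl i) - y (Sum.inr (Sum.inl j))
        = (((k : ℝ) + 1) * b + 2 * (k + a) * k) / (k * (k + a) * (k + a + b)) := by
  have hk0 : (k : ℝ) ≠ 0 := by positivity
  have hp : (k + a : ℝ) ≠ 0 := by positivity
  have ht : (k + a + b : ℝ) ≠ 0 := by positivity
  refine ⟨Sum.elim (fun l => if l = i then 1 / (k + a + b : ℝ) else 0)
    (Sum.elim (fun l => -b / (k * (k + a + b) * (k + a)) - if l = j then 1 / (k + a : ℝ) else 0)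
      (fun _ => 1 / (k * (k + a + b)))), ?_, ?_⟩
  · rw [lapMat_KCoal_mulVec]
    ext u
    rcases u with l | l | l
    · by_cases h : l = i <;>
        simp [h, Finset.sum_sub_distrib] <;> field_simp <;> ring
    · by_cases h : l = j <;>
        simp [h, Finset.sum_sub_distrib] <;> field_simp <;> ring
    · simp
      field_simp
      ring
  · simp
    field_simp
    ring

/-- In `K_{p₁} ∘ₖ K_{p₂}` with `k ≥ 1`, `p₁ > k`, `p₂ ≥ k` and `t = p₁ + p₂ − k`, the
resistance distance between an identified vertex and a non-identified vertex of
`K_{p₁}` equals `((k+1)(p₂−k) + 2p₁k)/(k·p₁·t)`. -/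
theorem resistance_coal_TA (k p₁ p₂ : ℕ) (hk : 1 ≤ k) (h1 : k < p₁) (h2 : k ≤ p₂)
    (i : Fin k) (j : Fin (p₁ - k))
    (X : Matrix (CoalV k (p₁ - k) (p₂ - k)) (CoalV k (p₁ - k) (p₂ - k)) ℝ)
    (hX : lapMat (KCoal k (p₁ - k) (p₂ - k)) * X * lapMat (KCoal k (p₁ - k) (p₂ - k))
        = lapMat (KCoal k (p₁ - k) (p₂ - k))) :
    X (Sum.inl i) (Sum.inl i) + X (Sum.inr (Sum.inl j)) (Sum.inr (Sum.inl j))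
      - X (Sum.inl i) (Sum.inr (Sum.inl j)) - X (Sum.inr (Sum.inl j)) (Sum.inl i)
      = (((k : ℝ) + 1) * ((p₂ : ℝ) - (k : ℝ)) + 2 * (p₁ : ℝ) * (k : ℝ))
          / ((k : ℝ) * (p₁ : ℝ) * ((p₁ : ℝ) + (p₂ : ℝ) - (k : ℝ))) := by
  obtain ⟨y, hy, hr⟩ := exists_potential_KCoal k (p₁ - k) (p₂ - k) hk i j
  rw [resistance_eq_potential_diff _ X hX y _ _ hy, hr, Nat.cast_sub h1.le, Nat.cast_sub h2]
  congr 1 <;> ring
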